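/- Every element f of Thompson's group F is represented by exactly one reduced pair of binary trees: there exists a unique pair (S, T) of binary trees with equal leaf counts such that (S, T) represents f and (S, T) is reduced. -/

import Mathlib

/-- A real number is dyadic if it has the form `a / 2 ^ b` with `a : ℤ`, `b : ℕ`. -/
def IsDyadic (x : ℝ) : Prop := ∃ (a : ℤ) (b : ℕ), x = (a : ℝ) / 2 ^ b

/-- `f : ℝ → ℝ` is (the extension of) an element of Thompson's group `F`:
a self-homeomorphism of `[0,1]` (continuous bijection of the compact interval onto itself)
fixing the endpoints, which is piecewise affine with dyadic breakpoints and slopes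
integer powers of `2`. -/
def InThompsonF (f : ℝ → ℝ) : Prop :=
  f 0 = 0 ∧ f 1 = 1 ∧
  ContinuousOn f (Set.Icc 0 1) ∧
  Set.BijOn f (Set.Icc 0 1) (Set.Icc 0 1) ∧
  ∃ (n : ℕ) (x : ℕ → ℝ), 0 < n ∧ x 0 = 0 ∧ x n = 1 ∧
    (∀ i < n, x i < x (i + 1)) ∧
    (∀ i ≤ n, IsDyadic (x i)) ∧
    (∀ i < n, ∃ (k : ℤ) (c : ℝ), ∀ t ∈ Set.Icc (x i) (x (i + 1)),
      f t = (2 : ℝ) ^ k * t + c)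


/-- A planar rooted binary tree. -/
inductive BinTree : Type
  | leaf : BinTree
  | node : BinTree → BinTree → BinTree
deriving DecidableEq

/-- The number of leaves of a binary tree. -/
def BinTree.numLeaves : BinTree → ℕ
  | .leaf => 1
  | .node l r => l.numLeaves + r.numLeaves

/-- The list of intervals (recorded as pairs of endpoints) that a binary tree associates to the
interval `[a, b]`: a leaf yields `[a,b]` itself, and a node splits `[a,b]` at its midpoint. -/
noncomputable def treePartition : BinTree → ℝ → ℝ → List (ℝ × ℝ)
  | .leaf, a, b => [(a, b)]
  | .node l r, a, b => treePartition l a ((a + b) / 2) ++ treePartition r ((a + b) / 2) b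

/-- A pair `(S, T)` of binary trees with the same number of leaves represents `f` if `f` maps
the `i`-th interval of the partition `P(S)` affinely onto the `i`-th interval of `P(T)`,
for every `i`. -/
def Represents (S T : BinTree) (f : ℝ → ℝ) : Prop :=
  S.numLeaves = T.numLeaves ∧
  ∀ i < S.numLeaves,
    (∃ k c : ℝ,
      ∀ t ∈ Set.Icc ((treePartition S 0 1)[i]!).1 ((treePartition S 0 1)[i]!).2,
        f t = k * t + c) ∧
    f '' Set.Icc ((treePartition S 0 1)[i]!).1 ((treePartition S 0 1)[i]!).2 =
      Set.Icc ((treePartition T 0 1)[i]!).1 ((treePartition T 0 1)[i]!).2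

/-- Caret insertion at the `i`-th leaf (leaves numbered from `0`, left to right): replace the
`i`-th leaf of `t` by `node leaf leaf`. -/
def caretInsert : BinTree → ℕ → BinTree
  | .leaf, _ => .node .leaf .leaf
  | .node l r, i =>
      if i < l.numLeaves then .node (caretInsert l i) r
      else .node l (caretInsert r (i - l.numLeaves))

/-- A pair `(S, T)` of binary trees is reduced if it is not obtained from another pair by
inserting a caret at the same leaf index of both trees. -/
def ReducedPair (S T : BinTree) : Prop :=
  ¬ ∃ (S' T' : BinTree) (i : ℕ), S'.numLeaves = T'.numLeaves ∧ i < S'.numLeaves ∧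
      S = caretInsert S' i ∧ T = caretInsert T' i

/-! ### Chains of intervals -/

/-- `L` is a list of consecutive nondegenerate intervals from `a` to `b`. -/
def ChainL : ℝ → ℝ → List (ℝ × ℝ) → Prop
  | a, b, [] => a = b
  | a, b, p :: L => p.1 = a ∧ p.1 < p.2 ∧ ChainL p.2 b L

lemma ChainL.le {L : List (ℝ × ℝ)} : ∀ {a b : ℝ}, ChainL a b L → a ≤ b := by
  induction L with
  | nil => intro a b h; exact le_of_eq h
  | cons p L ih =>
    intro a b h
    obtain ⟨h1, h2, h3⟩ := h
    have := ih h3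
    linarith

lemma ChainL.mem_bounds {L : List (ℝ × ℝ)} : ∀ {a b : ℝ}, ChainL a b L →
    ∀ p ∈ L, a ≤ p.1 ∧ p.1 < p.2 ∧ p.2 ≤ b := by
  induction L with
  | nil => intro a b h p hp; simp at hp
  | cons q L ih =>
    intro a b h p hp
    obtain ⟨h1, h2, h3⟩ := h
    rcases List.mem_cons.1 hp with rfl | hp
    · exact ⟨h1.ge, h2, h3.le⟩
    · obtain ⟨h4, h5, h6⟩ := ih h3 p hp
      exact ⟨by linarith, h5, h6⟩

lemma ChainL.eq_nil {L : List (ℝ × ℝ)} {a : ℝ} (h : ChainL a a L) : L = [] := by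
  cases L with
  | nil => rfl
  | cons p L =>
    obtain ⟨h1, h2, h3⟩ := h
    have := h3.le
    linarith

lemma ChainL.append {L L' : List (ℝ × ℝ)} : ∀ {a b c : ℝ}, ChainL a b L → ChainL b c L' →
    ChainL a c (L ++ L') := by
  induction L with
  | nil => intro a b c h h'; cases h; exact h'
  | cons p L ih =>
    intro a b c h h'
    exact ⟨h.1, h.2.1, ih h.2.2 h'⟩

lemma ChainL.of_append {L L' : List (ℝ × ℝ)} : ∀ {a c : ℝ}, ChainL a c (L ++ L') →
    ∃ b, ChainL a b L ∧ ChainL b c L' := by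
  induction L with
  | nil => intro a c h; exact ⟨a, rfl, h⟩
  | cons p L ih =>
    intro a c h
    obtain ⟨b, hb, hb'⟩ := ih h.2.2
    exact ⟨b, ⟨h.1, h.2.1, hb⟩, hb'⟩

lemma ChainL.eq_singleton {L : List (ℝ × ℝ)} {a b : ℝ} (h : ChainL a b L) (hm : (a, b) ∈ L) :
    L = [(a, b)] := by
  cases L with
  | nil => simp at hm
  | cons p L =>
    obtain ⟨h1, h2, h3⟩ := h
    rcases List.mem_cons.1 hm with rfl | hm
    · rw [h3.eq_nil]
    · have := h3.mem_bounds _ hm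
      simp at this
      linarith

lemma ChainL.split {L : List (ℝ × ℝ)} : ∀ {a m b : ℝ}, ChainL a b L → a ≤ m → m ≤ b →
    (∀ p ∈ L, p.2 ≤ m ∨ m ≤ p.1) → ∃ L1 L2, L = L1 ++ L2 ∧ ChainL a m L1 ∧ ChainL m b L2 := by
  induction L with
  | nil =>
    intro a m b h h1 h2 _
    have h' : a = b := h
    exact ⟨[], [], rfl, le_antisymm h1 (h' ▸ h2), le_antisymm h2 (h' ▸ h1)⟩
  | cons p L ih =>
    intro a m b h h1 h2 hp
    rcases h1.eq_or_lt with rfl | h1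
    · exact ⟨[], p :: L, rfl, rfl, h⟩
    · obtain ⟨h3, h4, h5⟩ := h
      have : p.2 ≤ m := by
        rcases hp p (by simp) with h | h
        · exact h
        · linarith
      obtain ⟨L1, L2, e, c1, c2⟩ := ih h5 this h2 (fun q hq => hp q (by simp [hq]))
      exact ⟨p :: L1, L2, by simp [e], ⟨h3, h4, c1⟩, c2⟩

lemma ChainL.append_inj {L1 : List (ℝ × ℝ)} : ∀ {L1' L2 L2' : List (ℝ × ℝ)} {a m : ℝ},
    ChainL a m L1 → ChainL a m L1' → L1 ++ L2 = L1' ++ L2' → L1 = L1' ∧ L2 = L2' := by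
  induction L1 with
  | nil =>
    intro L1' L2 L2' a m h h' e
    cases h
    have := h'.eq_nil
    subst this
    simpa using e
  | cons p L ih =>
    intro L1' L2 L2' a m h h' e
    cases L1' with
    | nil =>
      cases h'
      have := h.eq_nil
      simp at this
    | cons q L' =>
      simp only [List.cons_append, List.cons.injEq] at e
      obtain ⟨rfl, e⟩ := e
      obtain ⟨r1, r2⟩ := ih h.2.2 h'.2.2 e
      exact ⟨by rw [r1], r2⟩

lemma ChainL.map {f : ℝ → ℝ} {L : List (ℝ × ℝ)} : ∀ {a b : ℝ}, ChainL a b L →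
    StrictMonoOn f (Set.Icc a b) → ChainL (f a) (f b) (L.map (fun p => (f p.1, f p.2))) := by
  induction L with
  | nil => intro a b h _; cases h; rfl
  | cons p L ih =>
    intro a b h hf
    obtain ⟨h1, h2, h3⟩ := h
    have := h3.le
    refine ⟨by simp [h1], ?_, ?_⟩
    · exact hf ⟨by linarith, by linarith⟩ ⟨by linarith, by linarith⟩ h2
    · exact ih h3 (hf.mono (Set.Icc_subset_Icc (by linarith) le_rfl))

/-! ### Tree partitions -/

lemma tp_chain (t : BinTree) : ∀ {a b : ℝ}, a < b → ChainL a b (treePartition t a b) := by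
  induction t with
  | leaf => intro a b h; exact ⟨rfl, h, rfl⟩
  | node l r ihl ihr =>
    intro a b h
    exact (ihl (by linarith)).append (ihr (by linarith))

lemma tp_length (t : BinTree) : ∀ (a b : ℝ), (treePartition t a b).length = t.numLeaves := by
  induction t with
  | leaf => intro a b; rfl
  | node l r ihl ihr => intro a b; simp [treePartition, BinTree.numLeaves, ihl, ihr]

lemma numLeaves_pos (t : BinTree) : 0 < t.numLeaves := by
  induction t with
  | leaf => simp [BinTree.numLeaves]
  | node l r ihl ihr => simp [BinTree.numLeaves]; omega

lemma tp_inj (t : BinTree) : ∀ (t' : BinTree) {a b : ℝ}, a < b →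
    treePartition t a b = treePartition t' a b → t = t' := by
  induction t with
  | leaf =>
    intro t' a b h e
    cases t' with
    | leaf => rfl
    | node l r =>
      have := congrArg List.length e
      rw [tp_length, tp_length] at this
      have := numLeaves_pos l
      have := numLeaves_pos r
      simp [BinTree.numLeaves] at *
      omega
  | node l r ihl ihr =>
    intro t' a b h e
    cases t' with
    | leaf =>
      have := congrArg List.length e
      rw [tp_length, tp_length] at this
      have := numLeaves_pos l
      have := numLeaves_pos r
      simp [BinTree.numLeaves] at *
      omega
    | node l' r' =>
      obtain ⟨e1, e2⟩ := ChainL.append_inj (tp_chain l (by linarith : a < (a + b) / 2))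
        (tp_chain l' (by linarith)) e
      rw [ihl l' (by linarith) e1, ihr r' (by linarith) e2]

lemma tp_caret (t : BinTree) : ∀ (i : ℕ) (a b : ℝ), i < t.numLeaves →
    ∃ L1 L2 x y, L1.length = i ∧ treePartition t a b = L1 ++ (x, y) :: L2 ∧
      treePartition (caretInsert t i) a b =
        L1 ++ (x, (x + y) / 2) :: ((x + y) / 2, y) :: L2 := by
  induction t with
  | leaf =>
    intro i a b h
    simp [BinTree.numLeaves] at h
    exact ⟨[], [], a, b, by simp [h], rfl, rfl⟩
  | node l r ihl ihr =>
    intro i a b h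
    by_cases hi : i < l.numLeaves
    · obtain ⟨L1, L2, x, y, h1, h2, h3⟩ := ihl i a ((a + b) / 2) hi
      refine ⟨L1, L2 ++ treePartition r ((a + b) / 2) b, x, y, h1, ?_, ?_⟩
      · simp [treePartition, h2]
      · simp [caretInsert, hi, treePartition, h3]
    · simp [BinTree.numLeaves] at h
      obtain ⟨L1, L2, x, y, h1, h2, h3⟩ := ihr (i - l.numLeaves) ((a + b) / 2) b (by omega)
      refine ⟨treePartition l a ((a + b) / 2) ++ L1, L2, x, y, ?_, ?_, ?_⟩
      · simp [tp_length, h1]; omega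
      · simp [treePartition, h2]
      · simp [caretInsert, hi, treePartition, h3]

/-! ### Standard dyadic intervals -/

/-- Standard dyadic interval of level `m`. -/
def StdL (m : ℕ) (a b : ℝ) : Prop := ∃ j : ℤ, a = j / 2 ^ m ∧ b = (j + 1) / 2 ^ m

lemma StdL.lt {m : ℕ} {a b : ℝ} (h : StdL m a b) : a < b := by
  obtain ⟨j, rfl, rfl⟩ := h
  have : (0 : ℝ) < 2 ^ m := by positivity
  gcongr
  linarith

lemma StdL.sub_eq {m : ℕ} {a b : ℝ} (h : StdL m a b) : b - a = 1 / 2 ^ m := by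
  obtain ⟨j, rfl, rfl⟩ := h
  ring

lemma StdL.left {m : ℕ} {a b : ℝ} (h : StdL m a b) : StdL (m + 1) a ((a + b) / 2) := by
  obtain ⟨j, rfl, rfl⟩ := h
  refine ⟨2 * j, ?_, ?_⟩
  · push_cast; field_simp; ring
  · push_cast; field_simp; ring

lemma StdL.right {m : ℕ} {a b : ℝ} (h : StdL m a b) : StdL (m + 1) ((a + b) / 2) b := by
  obtain ⟨j, rfl, rfl⟩ := h
  refine ⟨2 * j + 1, ?_, ?_⟩
  · push_cast; field_simp; ring
  · push_cast; field_simp; ring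

/-- A dyadic number of level at most `l` does not lie strictly inside a level `l` interval. -/
lemma StdL.not_inside {l : ℕ} {x y c : ℝ} (h : StdL l x y) {k : ℕ} (hk : k ≤ l) {j : ℤ}
    (hc : c = j / 2 ^ k) : y ≤ c ∨ c ≤ x := by
  obtain ⟨i, rfl, rfl⟩ := h
  obtain ⟨d, rfl⟩ := Nat.exists_eq_add_of_le hk
  have hp : (0 : ℝ) < 2 ^ (k + d) := by positivity
  have hc' : c = ((j * 2 ^ d : ℤ) : ℝ) / 2 ^ (k + d) := by
    rw [hc]; push_cast; rw [pow_add]; field_simp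
  rw [hc']
  rcases lt_or_ge i (j * 2 ^ d) with h | h
  · left
    gcongr
    exact_mod_cast h
  · right
    gcongr

lemma exists_tree (n : ℕ) : ∀ (m : ℕ) (a b : ℝ) (L : List (ℝ × ℝ)), StdL m a b → ChainL a b L →
    (∀ p ∈ L, ∃ l ≤ m + n, StdL l p.1 p.2) → ∃ T, treePartition T a b = L := by
  induction n with
  | zero =>
    intro m a b L hs hc hL
    cases L with
    | nil => exact absurd hc (ne_of_lt hs.lt)
    | cons p L =>
      obtain ⟨l, hl, hp⟩ := hL p (by simp)
      obtain ⟨h1, h2, h3⟩ := hc.mem_bounds p (by simp)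
      have e1 := hs.sub_eq
      have e2 := hp.sub_eq
      have : (1 : ℝ) / 2 ^ m ≤ 1 / 2 ^ l := by
        apply one_div_le_one_div_of_le (by positivity)
        exact pow_le_pow_right₀ (by norm_num) (by omega)
      refine ⟨.leaf, (hc.eq_singleton ?_).symm⟩
      have : (a, b) = p := by ext <;> simp <;> linarith
      rw [this]; simp
  | succ n ih =>
    intro m a b L hs hc hL
    by_cases hab : (a, b) ∈ L
    · exact ⟨.leaf, (hc.eq_singleton hab).symm⟩
    have hlev : ∀ p ∈ L, ∃ l ≤ m + 1 + n, m < l ∧ StdL l p.1 p.2 := by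
      intro p hpL
      obtain ⟨l, hl, hp⟩ := hL p hpL
      refine ⟨l, by omega, ?_, hp⟩
      by_contra hlm
      obtain ⟨h1, h2, h3⟩ := hc.mem_bounds p hpL
      have e1 := hs.sub_eq
      have e2 := hp.sub_eq
      have : (1 : ℝ) / 2 ^ m ≤ 1 / 2 ^ l := by
        apply one_div_le_one_div_of_le (by positivity)
        exact pow_le_pow_right₀ (by norm_num) (by omega)
      have : (a, b) = p := by ext <;> simp <;> linarith
      exact hab (this ▸ hpL)
    have hlt := hs.lt
    obtain ⟨L1, L2, e, c1, c2⟩ := hc.split (m := (a + b) / 2) (by linarith) (by linarith) (by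
      intro p hp
      obtain ⟨l, _, hl, h⟩ := hlev p hp
      obtain ⟨j, hj, _⟩ := hs.right
      exact h.not_inside (k := m + 1) (by omega) hj)
    obtain ⟨T1, hT1⟩ := ih (m + 1) _ _ L1 hs.left c1 (fun p hp => by
      obtain ⟨l, h1, _, h2⟩ := hlev p (by simp [e, hp])
      exact ⟨l, h1, h2⟩)
    obtain ⟨T2, hT2⟩ := ih (m + 1) _ _ L2 hs.right c2 (fun p hp => by
      obtain ⟨l, h1, _, h2⟩ := hlev p (by simp [e, hp])
      exact ⟨l, h1, h2⟩)
    exact ⟨.node T1 T2, by simp [treePartition, hT1, hT2, e]⟩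

/-- Being a standard dyadic interval of some level. -/
def Std (p : ℝ × ℝ) : Prop := ∃ m, StdL m p.1 p.2

lemma stdL_unit : StdL 0 0 1 := ⟨0, by simp, by simp⟩

lemma exists_tree_unit (L : List (ℝ × ℝ)) (hc : ChainL 0 1 L) (hL : ∀ p ∈ L, Std p) :
    ∃ T, treePartition T 0 1 = L := by
  have : ∃ N, ∀ p ∈ L, ∃ l ≤ N, StdL l p.1 p.2 := by
    clear hc
    induction L with
    | nil => exact ⟨0, by simp⟩
    | cons p L ih =>
      obtain ⟨N, hN⟩ := ih (fun q hq => hL q (by simp [hq]))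
      obtain ⟨m, hm⟩ := hL p (by simp)
      refine ⟨max N m, ?_⟩
      intro q hq
      rcases List.mem_cons.1 hq with rfl | hq
      · exact ⟨m, le_max_right _ _, hm⟩
      · obtain ⟨l, h1, h2⟩ := hN q hq
        exact ⟨l, h1.trans (le_max_left _ _), h2⟩
  obtain ⟨N, hN⟩ := this
  exact exists_tree N 0 0 1 L stdL_unit hc (by simpa using hN)

lemma tp_std (t : BinTree) : ∀ {a b : ℝ}, Std (a, b) → ∀ p ∈ treePartition t a b, Std p := by
  induction t with
  | leaf => intro a b h p hp; simp [treePartition] at hp; exact hp ▸ h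
  | node l r ihl ihr =>
    intro a b h p hp
    obtain ⟨m, hm⟩ := h
    simp only [treePartition, List.mem_append] at hp
    rcases hp with hp | hp
    · exact ihl ⟨_, hm.left⟩ p hp
    · exact ihr ⟨_, hm.right⟩ p hp

/-- If the partition of `T` has two consecutive halves of a standard interval then `T` is a caret
insertion. -/
lemma caret_of_halves (T : BinTree) (L1 L2 : List (ℝ × ℝ)) (x y : ℝ) (hxy : Std (x, y))
    (h : treePartition T 0 1 = L1 ++ (x, (x + y) / 2) :: ((x + y) / 2, y) :: L2) :
    ∃ T', L1.length < T'.numLeaves ∧ T = caretInsert T' L1.length := by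
  have hc := tp_chain T (zero_lt_one' ℝ)
  have hstd := tp_std T (a := 0) (b := 1) ⟨0, stdL_unit⟩
  rw [h] at hc hstd
  obtain ⟨c, hc1, hc2⟩ := hc.of_append
  obtain ⟨h1, h2, h3, h4, h5⟩ := hc2
  simp at h1 h2 h4 h5
  have hc' : ChainL 0 1 (L1 ++ (x, y) :: L2) :=
    hc1.append ⟨h1, by simp; linarith, h5⟩
  obtain ⟨T', hT'⟩ := exists_tree_unit _ hc' (by
    intro p hp
    simp only [List.mem_append, List.mem_cons] at hp
    rcases hp with hp | rfl | hp
    · exact hstd p (by simp [hp])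
    · exact hxy
    · exact hstd p (by simp [hp]))
  have hlen : L1.length < T'.numLeaves := by
    rw [← tp_length T' 0 1, hT']; simp
  refine ⟨T', hlen, ?_⟩
  apply tp_inj _ _ (zero_lt_one' ℝ)
  obtain ⟨M1, M2, x', y', e1, e2, e3⟩ := tp_caret T' L1.length 0 1 hlen
  rw [e3, h]
  rw [e2] at hT'
  obtain ⟨r1, r2⟩ := List.append_inj hT' e1
  simp at r2
  obtain ⟨⟨rfl, rfl⟩, rfl⟩ := r2
  rw [r1]

/-! ### Descendants -/

/-- `Desc a b x y`: `[x,y]` is obtained from `[a,b]` by iterated halving. -/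
inductive Desc : ℝ → ℝ → ℝ → ℝ → Prop
  | refl (a b : ℝ) : Desc a b a b
  | left (a b x y : ℝ) : Desc a ((a + b) / 2) x y → Desc a b x y
  | right (a b x y : ℝ) : Desc ((a + b) / 2) b x y → Desc a b x y

lemma Desc.bounds {a b x y : ℝ} (h : Desc a b x y) : a < b → a ≤ x ∧ x < y ∧ y ≤ b := by
  induction h with
  | refl a b => intro h; exact ⟨le_rfl, h, le_rfl⟩
  | left a b x y _ ih =>
    intro h
    obtain ⟨h1, h2, h3⟩ := ih (by linarith)
    exact ⟨by linarith, h2, by linarith⟩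
  | right a b x y _ ih =>
    intro h
    obtain ⟨h1, h2, h3⟩ := ih (by linarith)
    exact ⟨by linarith, h2, by linarith⟩

lemma Desc.std {a b x y : ℝ} (h : Desc a b x y) : Std (a, b) → Std (x, y) := by
  induction h with
  | refl a b => exact id
  | left a b x y _ ih => rintro ⟨m, hm⟩; exact ih ⟨_, hm.left⟩
  | right a b x y _ ih => rintro ⟨m, hm⟩; exact ih ⟨_, hm.right⟩

lemma Desc.affine (k c : ℝ) {a b x y : ℝ} (h : Desc a b x y) :
    Desc (k * a + c) (k * b + c) (k * x + c) (k * y + c) := by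
  induction h with
  | refl a b => exact .refl _ _
  | left a b x y _ ih =>
    apply Desc.left
    convert ih using 1
    ring
  | right a b x y _ ih =>
    apply Desc.right
    convert ih using 1
    ring

lemma exists_caret (t : BinTree) : ∀ (a b : ℝ), t ≠ .leaf → ∃ L1 L2 x y, Desc a b x y ∧
    treePartition t a b = L1 ++ (x, (x + y) / 2) :: ((x + y) / 2, y) :: L2 := by
  induction t with
  | leaf => intro a b h; exact absurd rfl h
  | node l r ihl ihr =>
    intro a b _
    by_cases hl : l = .leaf
    · by_cases hr : r = .leaf
      · subst hl hr
        exact ⟨[], [], a, b, .refl _ _, rfl⟩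
      · obtain ⟨L1, L2, x, y, h1, h2⟩ := ihr ((a + b) / 2) b hr
        exact ⟨treePartition l a ((a + b) / 2) ++ L1, L2, x, y, .right _ _ _ _ h1,
          by simp [treePartition, h2]⟩
    · obtain ⟨L1, L2, x, y, h1, h2⟩ := ihl a ((a + b) / 2) hl
      exact ⟨L1, L2 ++ treePartition r ((a + b) / 2) b, x, y, .left _ _ _ _ h1,
        by simp [treePartition, h2]⟩

/-- `U` has a caret whose interval lies below a leaf of `V`. -/
def HasCaretBelow (U V : BinTree) (a b : ℝ) : Prop :=
  ∃ L1 L2 x y, treePartition U a b = L1 ++ (x, (x + y) / 2) :: ((x + y) / 2, y) :: L2 ∧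
    ∃ p ∈ treePartition V a b, Desc p.1 p.2 x y

lemma HasCaretBelow.left {U V : BinTree} (U' V' : BinTree) {a b : ℝ}
    (h : HasCaretBelow U V a ((a + b) / 2)) : HasCaretBelow (.node U U') (.node V V') a b := by
  obtain ⟨L1, L2, x, y, h1, p, hp, hd⟩ := h
  exact ⟨L1, L2 ++ treePartition U' ((a + b) / 2) b, x, y, by simp [treePartition, h1],
    p, by simp [treePartition, hp], hd⟩

lemma HasCaretBelow.right {U V : BinTree} (U' V' : BinTree) {a b : ℝ}
    (h : HasCaretBelow U V ((a + b) / 2) b) : HasCaretBelow (.node U' U) (.node V' V) a b := by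
  obtain ⟨L1, L2, x, y, h1, p, hp, hd⟩ := h
  exact ⟨treePartition U' a ((a + b) / 2) ++ L1, L2, x, y, by simp [treePartition, h1],
    p, by simp [treePartition, hp], hd⟩

lemma caret_below_trichotomy (U : BinTree) : ∀ (V : BinTree) (a b : ℝ),
    U = V ∨ HasCaretBelow U V a b ∨ HasCaretBelow V U a b := by
  induction U with
  | leaf =>
    intro V a b
    by_cases hV : V = .leaf
    · exact .inl hV.symm
    · obtain ⟨L1, L2, x, y, h1, h2⟩ := exists_caret V a b hV
      exact .inr (.inr ⟨L1, L2, x, y, h2, (a, b), by simp [treePartition], h1⟩)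
  | node l r ihl ihr =>
    intro V a b
    cases V with
    | leaf =>
      obtain ⟨L1, L2, x, y, h1, h2⟩ := exists_caret (.node l r) a b (by simp)
      exact .inr (.inl ⟨L1, L2, x, y, h2, (a, b), by simp [treePartition], h1⟩)
    | node l' r' =>
      rcases ihl l' a ((a + b) / 2) with rfl | h | h
      · rcases ihr r' ((a + b) / 2) b with rfl | h | h
        · exact .inl rfl
        · exact .inr (.inl (h.right _ _))
        · exact .inr (.inr (h.right _ _))
      · exact .inr (.inl (h.left _ _))
      · exact .inr (.inr (h.left _ _))

/-! ### Representation in list form -/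

/-- List form of `Represents`. -/
def TreeRep (S T : BinTree) (f : ℝ → ℝ) : Prop :=
  treePartition T 0 1 = (treePartition S 0 1).map (fun p => (f p.1, f p.2)) ∧
  ∀ p ∈ treePartition S 0 1, ∃ k c : ℝ, ∀ t ∈ Set.Icc p.1 p.2, f t = k * t + c

lemma Icc_inj_of_lt {a b c d : ℝ} (h : a < b) (e : Set.Icc a b = Set.Icc c d) :
    a = c ∧ b = d := by
  have hcd : c ≤ d := by
    rw [← Set.nonempty_Icc, ← e, Set.nonempty_Icc]; exact h.le
  have h1 := (Set.Icc_subset_Icc_iff h.le).1 e.subset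
  have h2 := (Set.Icc_subset_Icc_iff hcd).1 e.superset
  exact ⟨le_antisymm h2.1 h1.1, le_antisymm h1.2 h2.2⟩

lemma represents_iff {f : ℝ → ℝ} (hm : StrictMonoOn f (Set.Icc 0 1))
    (hc : ContinuousOn f (Set.Icc 0 1)) (S T : BinTree) : Represents S T f ↔ TreeRep S T f := by
  have himg : ∀ p ∈ treePartition S 0 1,
      f '' Set.Icc p.1 p.2 = Set.Icc (f p.1) (f p.2) ∧ f p.1 < f p.2 := by
    intro p hp
    obtain ⟨h1, h2, h3⟩ := (tp_chain S (zero_lt_one' ℝ)).mem_bounds p hp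
    have hsub : Set.Icc p.1 p.2 ⊆ Set.Icc 0 1 := Set.Icc_subset_Icc h1 h3
    exact ⟨(hc.mono hsub).image_Icc_of_monotoneOn h2.le (hm.monotoneOn.mono hsub),
      hm ⟨h1, by linarith⟩ ⟨by linarith, h3⟩ h2⟩
  have hSl := tp_length S 0 1
  have hTl := tp_length T 0 1
  constructor
  · rintro ⟨hlen, h⟩
    refine ⟨?_, ?_⟩
    · apply List.ext_getElem
      · simp [hSl, hTl, hlen]
      · intro i h1 h2
        have hi : i < S.numLeaves := by omega
        obtain ⟨_, h3⟩ := h i hi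
        have hi' : i < (treePartition S 0 1).length := by omega
        rw [getElem!_pos _ i hi', getElem!_pos _ i h1] at h3
        obtain ⟨h4, h5⟩ := himg _ (List.getElem_mem hi')
        rw [h4] at h3
        obtain ⟨e1, e2⟩ := Icc_inj_of_lt h5 h3
        simp only [List.getElem_map]
        rw [e1, e2]
    · intro p hp
      obtain ⟨i, hi, rfl⟩ := List.getElem_of_mem hp
      have := (h i (by omega)).1
      rwa [getElem!_pos _ i hi] at this
  · rintro ⟨h1, h2⟩
    have hlen : S.numLeaves = T.numLeaves := by
      have := congrArg List.length h1
      simp at this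
      omega
    refine ⟨hlen, fun i hi => ?_⟩
    have hi' : i < (treePartition S 0 1).length := by omega
    have hi'' : i < (treePartition T 0 1).length := by omega
    rw [getElem!_pos _ i hi', getElem!_pos _ i hi'']
    refine ⟨h2 _ (List.getElem_mem hi'), ?_⟩
    rw [(himg _ (List.getElem_mem hi')).1]
    have : (treePartition T 0 1)[i] =
        (f (treePartition S 0 1)[i].1, f (treePartition S 0 1)[i].2) := by
      simp [h1]
    rw [this]

lemma TreeRep.numLeaves_eq {S T : BinTree} {f : ℝ → ℝ} (h : TreeRep S T f) :
    S.numLeaves = T.numLeaves := by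
  have := congrArg List.length h.1
  simp [tp_length] at this
  omega

/-- Removing a common caret preserves being a representing pair. -/
lemma TreeRep.of_caret {S T : BinTree} {f : ℝ → ℝ} {i : ℕ} (hi : i < S.numLeaves)
    (hi' : i < T.numLeaves) (h : TreeRep (caretInsert S i) (caretInsert T i) f) : TreeRep S T f := by
  obtain ⟨L1, L2, x, y, h1, h2, h3⟩ := tp_caret S i 0 1 hi
  obtain ⟨M1, M2, u, v, g1, g2, g3⟩ := tp_caret T i 0 1 hi'
  obtain ⟨e, ha⟩ := h
  rw [h3] at e ha
  rw [g3] at e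
  simp only [List.map_append, List.map_cons] at e
  obtain ⟨e1, e2⟩ := List.append_inj e (by simp [h1, g1])
  simp only [List.cons.injEq, Prod.mk.injEq] at e2
  obtain ⟨⟨e3, e4⟩, ⟨-, e5⟩, e6⟩ := e2
  have hch := tp_chain S (zero_lt_one' ℝ)
  obtain ⟨-, hxy, -⟩ := hch.mem_bounds (x, y) (by simp [h2])
  simp only at hxy
  refine ⟨?_, ?_⟩
  · rw [h2, g2]
    simp [e1, e3, e5, e6]
  · rw [h2]
    intro p hp
    simp only [List.mem_append, List.mem_cons] at hp
    rcases hp with hp | rfl | hp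
    · exact ha p (by simp [hp])
    · obtain ⟨k, c, hk⟩ := ha (x, (x + y) / 2) (by simp)
      obtain ⟨k', c', hk'⟩ := ha ((x + y) / 2, y) (by simp)
      simp only at hk hk'
      have a1 := hk x ⟨le_rfl, by linarith⟩
      have a2 := hk ((x + y) / 2) ⟨by linarith, le_rfl⟩
      have a3 := hk' ((x + y) / 2) ⟨le_rfl, by linarith⟩
      have a4 := hk' y ⟨by linarith, le_rfl⟩
      have hkk : k = k' := by
        have : (k - k') * (y - x) = 0 := by linarith
        rcases mul_eq_zero.1 this with h | h <;> linarith
      subst hkk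
      have hcc : c = c' := by linarith
      subst hcc
      refine ⟨k, c, fun t ht => ?_⟩
      rcases le_total t ((x + y) / 2) with h | h
      · exact hk t ⟨ht.1, h⟩
      · exact hk' t ⟨h, ht.2⟩
    · exact ha p (by simp [hp])

/-- Any representing pair gives a reduced representing pair. -/
lemma exists_reduced {f : ℝ → ℝ} (h : ∃ S T, TreeRep S T f) :
    ∃ S T, TreeRep S T f ∧ ReducedPair S T := by
  classical
  have hex : ∃ n, ∃ S T, TreeRep S T f ∧ S.numLeaves = n := by
    obtain ⟨S, T, h⟩ := h
    exact ⟨_, S, T, h, rfl⟩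
  obtain ⟨S, T, hr, hn⟩ := Nat.find_spec hex
  refine ⟨S, T, hr, ?_⟩
  rintro ⟨S', T', i, e, hi, rfl, rfl⟩
  have hr' := hr.of_caret hi (e ▸ hi)
  refine Nat.find_min hex ?_ ⟨S', T', hr', rfl⟩
  rw [← hn]
  obtain ⟨L1, L2, x, y, h1, h2, h3⟩ := tp_caret S' i 0 1 hi
  rw [← tp_length S' 0 1, ← tp_length (caretInsert S' i) 0 1, h2, h3]
  simp

lemma not_caretBelow {f : ℝ → ℝ} {S T S2 T2 : BinTree} (h : TreeRep S T f) (hred : ReducedPair S T)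
    (h2 : TreeRep S2 T2 f) : ¬ HasCaretBelow S S2 0 1 := by
  rintro ⟨L1, L2, x, y, hS, p, hp, hd⟩
  have hu : Std ((0 : ℝ), (1 : ℝ)) := ⟨0, stdL_unit⟩
  have hps := tp_std S2 hu p hp
  have hxy := hd.std hps
  obtain ⟨k, c, hk⟩ := h2.2 p hp
  obtain ⟨-, hlt, -⟩ := (tp_chain S2 (zero_lt_one' ℝ)).mem_bounds p hp
  obtain ⟨b1, b2, b3⟩ := hd.bounds hlt
  have hfx := hk x ⟨b1, by linarith⟩
  have hfy := hk y ⟨by linarith, b3⟩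
  have hfm := hk ((x + y) / 2) ⟨by linarith, by linarith⟩
  have hfd := hd.affine k c
  rw [← hfx, ← hfy, ← hk p.1 ⟨le_rfl, hlt.le⟩, ← hk p.2 ⟨hlt.le, le_rfl⟩] at hfd
  have hfp : Std (f p.1, f p.2) := by
    apply tp_std T2 hu
    rw [h2.1]
    exact List.mem_map_of_mem (f := fun p : ℝ × ℝ => (f p.1, f p.2)) hp
  have hfxy := hfd.std hfp
  have hmid : f ((x + y) / 2) = (f x + f y) / 2 := by rw [hfx, hfy, hfm]; ring
  have hT := h.1
  rw [hS] at hT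
  simp only [List.map_append, List.map_cons, hmid] at hT
  obtain ⟨S', hS1, hS2⟩ := caret_of_halves S _ _ x y hxy hS
  obtain ⟨T', hT1, hT2⟩ := caret_of_halves T _ _ _ _ hfxy hT
  simp only [List.length_map] at hT1 hT2
  refine hred ⟨S', T', L1.length, ?_, hS1, hS2, hT2⟩
  have hn := h.numLeaves_eq
  obtain ⟨A1, A2, u, v, r1, r2, r3⟩ := tp_caret S' _ 0 1 hS1
  obtain ⟨B1, B2, u', v', s1, s2, s3⟩ := tp_caret T' _ 0 1 hT1
  rw [← hS2] at r3
  rw [← hT2] at s3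
  have q1 := congrArg List.length r2
  have q2 := congrArg List.length r3
  have q3 := congrArg List.length s2
  have q4 := congrArg List.length s3
  simp [tp_length] at q1 q2 q3 q4
  omega

lemma rep_unique {f : ℝ → ℝ} {S T S2 T2 : BinTree} (h : TreeRep S T f) (hred : ReducedPair S T)
    (h2 : TreeRep S2 T2 f) (hred2 : ReducedPair S2 T2) : S = S2 ∧ T = T2 := by
  have hS : S = S2 := by
    rcases caret_below_trichotomy S S2 0 1 with e | e | e
    · exact e
    · exact absurd e (not_caretBelow h hred h2)
    · exact absurd e (not_caretBelow h2 hred2 h)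
  subst hS
  exact ⟨rfl, tp_inj _ _ (zero_lt_one' ℝ) (h.1.trans h2.1.symm)⟩

/-! ### Existence -/

/-- The complete binary tree of depth `n`. -/
def fullTree : ℕ → BinTree
  | 0 => .leaf
  | n + 1 => .node (fullTree n) (fullTree n)

lemma fullTree_std (n : ℕ) : ∀ {m : ℕ} {a b : ℝ}, StdL m a b →
    ∀ p ∈ treePartition (fullTree n) a b, StdL (m + n) p.1 p.2 := by
  induction n with
  | zero => intro m a b h p hp; simp [treePartition, fullTree] at hp; subst hp; exact h
  | succ n ih =>
    intro m a b h p hp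
    simp only [treePartition, fullTree, List.mem_append] at hp
    rw [show m + (n + 1) = m + 1 + n by omega]
    rcases hp with hp | hp
    · exact ih h.left p hp
    · exact ih h.right p hp

/-- `f` is affine on `[a,b]` and takes it to a standard dyadic interval. -/
def Good (f : ℝ → ℝ) (a b : ℝ) : Prop :=
  (∃ k c : ℝ, ∀ t ∈ Set.Icc a b, f t = k * t + c) ∧ Std (f a, f b)

lemma IsDyadic.add {x y : ℝ} (hx : IsDyadic x) (hy : IsDyadic y) : IsDyadic (x + y) := by
  obtain ⟨a, b, rfl⟩ := hx
  obtain ⟨c, d, rfl⟩ := hy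
  refine ⟨a * 2 ^ d + c * 2 ^ b, b + d, ?_⟩
  push_cast
  rw [pow_add]
  field_simp

lemma IsDyadic.neg {x : ℝ} (hx : IsDyadic x) : IsDyadic (-x) := by
  obtain ⟨a, b, rfl⟩ := hx
  exact ⟨-a, b, by push_cast; ring⟩

lemma IsDyadic.zpow_mul {x : ℝ} (hx : IsDyadic x) (k : ℤ) : IsDyadic ((2 : ℝ) ^ k * x) := by
  obtain ⟨a, b, rfl⟩ := hx
  rcases Int.eq_nat_or_neg k with ⟨n, rfl | rfl⟩
  · refine ⟨2 ^ n * a, b, ?_⟩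
    push_cast
    rw [zpow_natCast]; ring
  · refine ⟨a, n + b, ?_⟩
    rw [zpow_neg, zpow_natCast, pow_add]
    field_simp

lemma good_piece {f : ℝ → ℝ} {k : ℤ} {c : ℝ} (hc : IsDyadic c) :
    ∃ N0 : ℕ, ∀ N ≥ N0, ∀ a b : ℝ, StdL N a b →
      (∀ t ∈ Set.Icc a b, f t = (2 : ℝ) ^ k * t + c) → Good f a b := by
  obtain ⟨C, d, rfl⟩ := hc
  refine ⟨k.toNat + d, fun N hN a b hab hf => ⟨⟨_, _, hf⟩, ?_⟩⟩
  obtain ⟨e, he⟩ : ∃ e : ℕ, (N : ℤ) = k + d + e := ⟨(N - k - d).toNat, by omega⟩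
  have hlt := hab.lt
  have hfa := hf a ⟨le_rfl, hlt.le⟩
  have hfb := hf b ⟨hlt.le, le_rfl⟩
  obtain ⟨j, rfl, rfl⟩ := hab
  have hk : (2 : ℝ) ^ k / 2 ^ N = 1 / 2 ^ (d + e) := by
    rw [← zpow_natCast, ← zpow_natCast, he, div_eq_div_iff (by positivity) (by positivity),
      ← zpow_add₀ (by norm_num), one_mul]
    congr 1
    push_cast; ring
  have hC : (C : ℝ) / 2 ^ d = C * 2 ^ e / 2 ^ (d + e) := by
    rw [pow_add]; field_simp
  refine ⟨d + e, j + C * 2 ^ e, ?_, ?_⟩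
  · simp only [hfa]
    rw [hC, show (2 : ℝ) ^ k * (j / 2 ^ N) = j * (2 ^ k / 2 ^ N) by ring, hk]
    push_cast; ring
  · simp only [hfb]
    rw [hC, show (2 : ℝ) ^ k * ((j + 1) / 2 ^ N) = (j + 1) * (2 ^ k / 2 ^ N) by ring, hk]
    push_cast; ring

lemma eventually_good {f : ℝ → ℝ} {n : ℕ} {x : ℕ → ℝ} (hf0 : f 0 = 0) (hx0 : x 0 = 0)
    (hlt : ∀ i < n, x i < x (i + 1)) (hd : ∀ i ≤ n, IsDyadic (x i))
    (ha : ∀ i < n, ∃ (k : ℤ) (c : ℝ), ∀ t ∈ Set.Icc (x i) (x (i + 1)),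
      f t = (2 : ℝ) ^ k * t + c) :
    ∀ i ≤ n, IsDyadic (f (x i)) ∧ ∃ N0 : ℕ, ∀ N ≥ N0, ∀ a b : ℝ, StdL N a b → 0 ≤ a → b ≤ x i →
      Good f a b := by
  intro i
  induction i with
  | zero =>
    intro _
    refine ⟨by rw [hx0, hf0]; exact ⟨0, 0, by simp⟩, 0, ?_⟩
    intro N _ a b hab h0 h1
    have := hab.lt
    linarith
  | succ i ih =>
    intro hi
    obtain ⟨h1, N0, hN0⟩ := ih (by omega)
    obtain ⟨k, c, hk⟩ := ha i (by omega)
    have hl := hlt i (by omega)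
    have e1 := hk (x i) ⟨le_rfl, hl.le⟩
    have e2 := hk (x (i + 1)) ⟨hl.le, le_rfl⟩
    have hc : IsDyadic c := by
      have : c = f (x i) + -((2 : ℝ) ^ k * x i) := by rw [e1]; ring
      rw [this]
      exact h1.add ((hd i (by omega)).zpow_mul k).neg
    refine ⟨by rw [e2]; exact ((hd _ hi).zpow_mul k).add hc, ?_⟩
    obtain ⟨N1, hN1⟩ := good_piece (f := f) (k := k) hc
    obtain ⟨A, B, hAB⟩ := hd i (by omega)
    refine ⟨N0 + N1 + B, fun N hN a b hab h0 hb => ?_⟩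
    rcases hab.not_inside (k := B) (by omega) hAB with h | h
    · exact hN0 N (by omega) a b hab h0 h
    · exact hN1 N (by omega) a b hab (fun t ht => hk t ⟨h.trans ht.1, ht.2.trans hb⟩)

lemma exists_rep {f : ℝ → ℝ} (hf : InThompsonF f) (hm : StrictMonoOn f (Set.Icc 0 1)) :
    ∃ S T, TreeRep S T f := by
  obtain ⟨hf0, hf1, -, -, n, x, -, hx0, hxn, hlt, hd, ha⟩ := hf
  obtain ⟨-, N, hN⟩ := eventually_good hf0 hx0 hlt hd ha n le_rfl
  have hch := tp_chain (fullTree N) (zero_lt_one' ℝ)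
  have hgood : ∀ p ∈ treePartition (fullTree N) 0 1, Good f p.1 p.2 := by
    intro p hp
    obtain ⟨h1, h2, h3⟩ := hch.mem_bounds p hp
    have := fullTree_std N stdL_unit p hp
    rw [zero_add] at this
    exact hN N le_rfl _ _ this h1 (by rw [hxn]; exact h3)
  have hch' := hch.map hm
  rw [hf0, hf1] at hch'
  obtain ⟨T, hT⟩ := exists_tree_unit _ hch' (by
    intro q hq
    obtain ⟨p, hp, rfl⟩ := List.mem_map.1 hq
    exact (hgood p hp).2)
  exact ⟨fullTree N, T, hT, fun p hp => (hgood p hp).1⟩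

/-- Every element of Thompson's group `F` is represented by exactly one reduced pair of
binary trees. -/
theorem thompsonF_unique_reduced_pair (f : ℝ → ℝ) (hf : InThompsonF f) :
    ∃! p : BinTree × BinTree, Represents p.1 p.2 f ∧ ReducedPair p.1 p.2 := by
  have hm : StrictMonoOn f (Set.Icc 0 1) :=
    hf.2.2.1.strictMonoOn_of_injOn_Icc zero_le_one (by rw [hf.1, hf.2.1]; exact zero_le_one)
      hf.2.2.2.1.injOn
  have hiff := represents_iff hm hf.2.2.1
  obtain ⟨S, T, h, hr⟩ := exists_reduced (exists_rep hf hm)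
  refine ⟨(S, T), ⟨(hiff S T).2 h, hr⟩, ?_⟩
  rintro ⟨S2, T2⟩ ⟨h2, hr2⟩
  obtain ⟨rfl, rfl⟩ := rep_unique h hr ((hiff _ _).1 h2) hr2
  rfl
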